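/- There is no semisimple real Lie algebra of dimension 5. -/

import Mathlib

open LieAlgebra LieAlgebra.IsKilling LieModule Module
open scoped TensorProduct

lemma isKilling_baseChange_aux (L : Type) [LieRing L] [LieAlgebra ℝ L] [Module.Finite ℝ L]
    [IsKilling ℝ L] : IsKilling ℂ (ℂ ⊗[ℝ] L) := by
  classical
  have h0 : (killingForm ℝ L).Nondegenerate := killingForm_nondegenerate ℝ L
  let b := Module.finBasis ℝ L
  have h1 := (LinearMap.BilinForm.nondegenerate_iff_det_ne_zero (B := killingForm ℝ L) b).1 h0
  have h2 : (killingForm ℂ (ℂ ⊗[ℝ] L)).Nondegenerate := by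
    rw [LinearMap.BilinForm.nondegenerate_iff_det_ne_zero (b.baseChange ℂ)]
    have : LinearMap.BilinForm.toMatrix (b.baseChange ℂ) (killingForm ℂ (ℂ ⊗[ℝ] L)) =
        (LinearMap.BilinForm.toMatrix b (killingForm ℝ L)).map (algebraMap ℝ ℂ) := by
      ext i j
      simp [LinearMap.BilinForm.toMatrix_apply, killingForm]
    rw [this, ← RingHom.mapMatrix_apply, ← RingHom.map_det]
    simpa using h1
  constructor
  rw [← LieSubmodule.toSubmodule_inj]
  exact (LieIdeal.coe_killingCompl_top ℂ (ℂ ⊗[ℝ] L)).trans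
    (LinearMap.separatingLeft_iff_ker_eq_bot.1 h2.1)

lemma finrank_sum_aux {L : Type} [LieRing L] [LieAlgebra ℂ L] [Module.Finite ℂ L]
    [IsKilling ℂ L] (H : LieSubalgebra ℂ L) [H.IsCartanSubalgebra] :
    finrank ℂ L = finrank ℂ H + H.root.card := by
  classical
  have hI : DirectSum.IsInternal (fun χ : Weight ℂ H L => (genWeightSpace L χ).toSubmodule) :=
    DirectSum.isInternal_submodule_of_iSupIndep_of_iSup_eq_top
      (LieSubmodule.iSupIndep_toSubmodule.mpr <| iSupIndep_genWeightSpace' ℂ H L)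
      (LieSubmodule.iSup_toSubmodule_eq_top.mpr <| iSup_genWeightSpace_eq_top' ℂ H L)
  have hs : finrank ℂ L = ∑ χ : Weight ℂ H L, finrank ℂ (genWeightSpace L χ).toSubmodule := by
    rw [← (LinearEquiv.ofBijective (DirectSum.coeLinearMap
      (fun χ : Weight ℂ H L => (genWeightSpace L χ).toSubmodule)) hI).finrank_eq, Module.finrank_directSum]
  have hz : ∀ χ : Weight ℂ H L, χ.IsZero →
      finrank ℂ (genWeightSpace L χ).toSubmodule = finrank ℂ H := by
    intro χ hχ
    have h1 : (χ : H → ℂ) = 0 := hχ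
    rw [h1]
    have := rootSpace_zero_eq ℂ L H
    change finrank ℂ (rootSpace H (0 : H → ℂ)).toSubmodule = _
    rw [this]
    rfl
  rw [hs, ← Finset.sum_filter_add_sum_filter_not Finset.univ (fun χ : Weight ℂ H L => χ.IsZero)]
  congr 1
  · rw [Finset.sum_congr rfl (fun χ hχ => hz χ (Finset.mem_filter.1 hχ).2)]
    rcases subsingleton_or_nontrivial H with h | h
    · simp [finrank_zero_of_subsingleton]
    · have : (Finset.univ.filter (fun χ : Weight ℂ H L => χ.IsZero)) = {0} := by
        ext χ
        simp [Weight.isZero_iff_eq_zero]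
      rw [this]; simp
  · rw [Finset.card_eq_sum_ones]
    refine Finset.sum_congr ?_ fun χ hχ => ?_
    · ext; simp
    · exact finrank_rootSpace_eq_one χ (by simpa using hχ)

lemma complex_aux (L : Type) [LieRing L] [LieAlgebra ℂ L] [Module.Finite ℂ L]
    [IsKilling ℂ L] : finrank ℂ L ≠ 5 := by
  classical
  obtain ⟨x, hx⟩ := LieAlgebra.exists_isCartanSubalgebra_engel ℂ L
  set H := LieSubalgebra.engel ℂ x
  have hs := finrank_sum_aux H
  have hd : finrank ℂ (Dual ℂ H) = finrank ℂ H := Subspace.dual_finrank_eq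
  have hspan := span_weight_isNonZero_eq_top ℂ L H
  by_cases h0 : ∃ α : Weight ℂ H L, α.IsNonZero
  · obtain ⟨α, hα⟩ := h0
    have hαn : α ≠ -α := fun h => hα (by
      have h2 : ∀ y, α y = -α y := fun y => by
        conv_lhs => rw [h]
        rfl
      funext y
      simpa using self_eq_neg.1 (h2 y))
    by_cases h1 : ∃ β : Weight ℂ H L, β.IsNonZero ∧ β ≠ -α ∧ β ≠ α
    · obtain ⟨β, hβ, hn, hp⟩ := h1
      have hβn : β ≠ -β := fun h => hβ (by
        have h2 : ∀ y, β y = -β y := fun y => by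
          conv_lhs => rw [h]
          rfl
        funext y
        simpa using self_eq_neg.1 (h2 y))
      have hc : ({α, -α, β, -β} : Finset (Weight ℂ H L)).card ≤ H.root.card := by
        apply Finset.card_le_card
        intro γ hγ
        simp only [Finset.mem_insert, Finset.mem_singleton] at hγ
        rcases hγ with rfl | rfl | rfl | rfl <;> simpa
      have hn' : α ≠ -β := fun h => hn (by rw [h, neg_neg])
      have h4 : ({α, -α, β, -β} : Finset (Weight ℂ H L)).card = 4 := by
        rw [Finset.card_insert_of_notMem, Finset.card_insert_of_notMem,
          Finset.card_insert_of_notMem, Finset.card_singleton]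
        · simpa using hβn
        · simp [hn.symm, hp.symm]
        · simp [hαn, hp.symm, hn']
      have hr : 2 ≤ finrank ℂ (Dual ℂ H) := by
        have hli : LinearIndependent ℂ ![Weight.toLinear ℂ H L α, Weight.toLinear ℂ H L β] := by
          rw [LinearIndependent.pair_iff' (by simpa using hα)]
          intro a ha
          have : (β : H → ℂ) = a • (α : H → ℂ) := by
            funext y
            exact (LinearMap.congr_fun ha y).symm
          rcases eq_neg_or_eq_of_eq_smul α β hβ a this with h | h
          · exact hn h
          · exact hp h
        simpa using hli.fintype_card_le_finrank
      omega
    · push Not at h1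
      have hc : H.root.card ≤ ({α, -α} : Finset (Weight ℂ H L)).card := by
        apply Finset.card_le_card
        intro γ hγ
        have := h1 γ (by simpa using hγ)
        simp only [Finset.mem_insert, Finset.mem_singleton]
        tauto
      have := Finset.card_le_two (a := α) (b := -α)
      have hr : finrank ℂ (Dual ℂ H) ≤ 1 := by
        rw [← finrank_top, ← hspan]
        refine (Submodule.finrank_mono (t := ℂ ∙ Weight.toLinear ℂ H L α) ?_).trans
          (finrank_span_le_card _ |>.trans (by simp))
        rw [Submodule.span_le]
        rintro _ ⟨γ, hγ, rfl⟩
        by_cases h : γ = -α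
        · subst h
          have : Weight.toLinear ℂ H L (-α) = - Weight.toLinear ℂ H L α := rfl
          rw [this]
          exact neg_mem (Submodule.mem_span_singleton_self _)
        · rw [h1 γ hγ h]
          exact Submodule.mem_span_singleton_self _
      omega
  · push Not at h0
    have hc : H.root.card = 0 := by
      rw [Finset.card_eq_zero, Finset.eq_empty_iff_forall_notMem]
      intro γ hγ
      have h1 : γ.IsNonZero := by simpa using hγ
      exact h1 (h0 γ)
    have hr : finrank ℂ (Dual ℂ H) = 0 := by
      rw [← finrank_top, ← hspan]
      have : {α : Weight ℂ H L | α.IsNonZero} = ∅ := by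
        ext γ; simpa using h0 γ
      rw [this]; simp
    omega

/-- There is no semisimple real Lie algebra of dimension 5. -/
theorem no_semisimple_real_lie_algebra_dim_five
    (L : Type) [LieRing L] [LieAlgebra ℝ L] [Module.Finite ℝ L]
    (h : Module.finrank ℝ L = 5) :
    ¬ LieAlgebra.IsSemisimple ℝ L := by
  intro hs
  have := isKilling_baseChange_aux L
  exact complex_aux (ℂ ⊗[ℝ] L) (by rw [Module.finrank_baseChange, h])
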